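/- Let p be a prime and n ≥ 1, with (n,p) not equal to (1,2), (1,3), or (2,2). Then the quotient of Sp(2n, ℤ/pℤ) by its center is a simple group. -/

import Mathlib

open Matrix

namespace SymplecticGroup

variable {l F : Type*} [DecidableEq l] [Fintype l] [Field F]

/-- The alternating bilinear form with matrix `J`. -/
noncomputable def form : LinearMap.BilinForm F (l ⊕ l → F) := Matrix.toBilin' (J l F)

theorem form_apply (v w : l ⊕ l → F) :
    form v w = ∑ i, (v (.inr i) * w (.inl i) - v (.inl i) * w (.inr i)) := by
  simp only [form, Matrix.toBilin'_apply', J, dotProduct, Fintype.sum_sum_type, fromBlocks_mulVec,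
    Finset.sum_sub_distrib]
  simp [neg_mulVec]
  ring

@[simp]
theorem form_self (v : l ⊕ l → F) : form v v = 0 := by
  rw [form_apply]
  exact Finset.sum_eq_zero fun i _ => by ring

theorem form_swap (v w : l ⊕ l → F) : form v w = -form w v := by
  rw [form_apply, form_apply, ← Finset.sum_neg_distrib]
  exact Finset.sum_congr rfl fun i _ => by ring

theorem form_single_inl (v : l ⊕ l → F) (i : l) : form v (Pi.single (.inl i) 1) = v (.inr i) := by
  simp [form_apply, Pi.single_apply]

theorem form_single_inr (v : l ⊕ l → F) (i : l) : form v (Pi.single (.inr i) 1) = -v (.inl i) := by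
  simp [form_apply, Pi.single_apply]

theorem form_nondegenerate {v : l ⊕ l → F} (h : ∀ w, form v w = 0) : v = 0 := by
  ext (i | i)
  · simpa [form_single_inr] using h (Pi.single (.inr i) 1)
  · simpa [form_single_inl] using h (Pi.single (.inl i) 1)

theorem exists_form_ne_zero {v : l ⊕ l → F} (h : v ≠ 0) : ∃ w, form v w ≠ 0 := by
  contrapose! h
  exact form_nondegenerate h

theorem mem_of_form {A : Matrix (l ⊕ l) (l ⊕ l) F}
    (h : ∀ v w, form (A *ᵥ v) (A *ᵥ w) = form v w) : A ∈ symplecticGroup l F := by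
  rw [mem_iff']
  apply Matrix.toBilin'.injective
  ext i j
  have := h (Pi.single i 1) (Pi.single j 1)
  simp only [form, Matrix.toBilin'_apply'] at this
  simp only [LinearMap.comp_apply, LinearMap.coe_single, Matrix.toBilin'_apply', ← this,
    dotProduct_mulVec, vecMul_mulVec, ← mulVec_mulVec]
  simp [Matrix.vecMul_transpose, ← vecMul_vecMul]

theorem form_mulVec (g : symplecticGroup l F) (v w : l ⊕ l → F) :
    form (g.1 *ᵥ v) (g.1 *ᵥ w) = form v w := by
  simp only [form, Matrix.toBilin'_apply']
  conv_rhs => rw [← mem_iff'.1 g.2]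
  simp only [dotProduct_mulVec, ← vecMul_vecMul, Matrix.vecMul_transpose]

theorem ext_mulVec {g h : symplecticGroup l F} (H : ∀ v, g.1 *ᵥ v = h.1 *ᵥ v) : g = h :=
  Subtype.ext (Matrix.ext_of_mulVec_single fun _ => H _)

@[simp]
theorem mul_mulVec (g h : symplecticGroup l F) (v : l ⊕ l → F) :
    (g * h).1 *ᵥ v = g.1 *ᵥ (h.1 *ᵥ v) := by
  simp

@[simp]
theorem one_mulVec (v : l ⊕ l → F) : (1 : symplecticGroup l F).1 *ᵥ v = v := by
  simp

theorem inv_mulVec_mulVec (g : symplecticGroup l F) (v : l ⊕ l → F) :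
    (g⁻¹).1 *ᵥ (g.1 *ᵥ v) = v := by
  rw [← mul_mulVec, inv_mul_cancel, one_mulVec]

theorem mulVec_inv_mulVec (g : symplecticGroup l F) (v : l ⊕ l → F) :
    g.1 *ᵥ ((g⁻¹).1 *ᵥ v) = v := by
  rw [← mul_mulVec, mul_inv_cancel, one_mulVec]

theorem mulVec_ne_zero (g : symplecticGroup l F) {v : l ⊕ l → F} (hv : v ≠ 0) :
    g.1 *ᵥ v ≠ 0 := by
  intro h
  apply hv
  rw [← inv_mulVec_mulVec g v, h, mulVec_zero]

/-- The symplectic transvection `v ↦ v + a ω(v, u) u`. -/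
noncomputable def transvection (u : l ⊕ l → F) (a : F) : symplecticGroup l F :=
  ⟨LinearMap.toMatrix' (LinearMap.transvection (a • form.flip u) u), mem_of_form fun v w => by
    have := form_swap w u
    simp only [LinearMap.toMatrix'_mulVec, LinearMap.transvection.apply, map_add, map_smul,
      LinearMap.add_apply, LinearMap.smul_apply, LinearMap.BilinForm.flip_apply, smul_eq_mul,
      form_self]
    rw [this]
    ring⟩

theorem transvection_mulVec (u : l ⊕ l → F) (a : F) (v : l ⊕ l → F) :
    (transvection u a).1 *ᵥ v = v + (a * form v u) • u := by
  simp [transvection, LinearMap.transvection.apply]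

theorem transvection_add (u : l ⊕ l → F) (a b : F) :
    transvection u (a + b) = transvection u a * transvection u b := by
  refine ext_mulVec fun v => ?_
  simp only [mul_mulVec, transvection_mulVec, map_add, map_smul, LinearMap.add_apply,
    LinearMap.smul_apply, smul_eq_mul, form_self]
  module

@[simp]
theorem transvection_zero (u : l ⊕ l → F) : transvection u 0 = 1 :=
  ext_mulVec fun v => by simp [transvection_mulVec]

theorem transvection_smul (u : l ⊕ l → F) (c a : F) :
    transvection (c • u) a = transvection u (c ^ 2 * a) := by
  refine ext_mulVec fun v => ?_
  simp only [transvection_mulVec, map_smul, smul_eq_mul]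
  module

theorem conj_transvection (g : symplecticGroup l F) (u : l ⊕ l → F) (a : F) :
    g * transvection u a * g⁻¹ = transvection (g.1 *ᵥ u) a := by
  refine ext_mulVec fun v => ?_
  have : form ((g⁻¹).1 *ᵥ v) u = form v (g.1 *ᵥ u) := by
    rw [← form_mulVec g, mulVec_inv_mulVec]
  simp only [mul_mulVec, transvection_mulVec, mulVec_add, mulVec_smul, mulVec_inv_mulVec, this]

theorem transvection_sub_mulVec {x y : l ⊕ l → F} (h : form x y ≠ 0) :
    (transvection (x - y) (form x y)⁻¹).1 *ᵥ x = y := by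
  simp [transvection_mulVec, h]

/-- The subgroup generated by the transvections along vectors of `W`. -/
def transvections (W : Submodule F (l ⊕ l → F)) : Subgroup (symplecticGroup l F) :=
  Subgroup.closure {t | ∃ u ∈ W, ∃ a, t = transvection u a}

theorem transvection_mem {W : Submodule F (l ⊕ l → F)} {u : l ⊕ l → F} (hu : u ∈ W) (a : F) :
    transvection u a ∈ transvections W :=
  Subgroup.subset_closure ⟨u, hu, a, rfl⟩

theorem mulVec_eq_self_of_mem_transvections {W : Submodule F (l ⊕ l → F)}
    {t : symplecticGroup l F} (ht : t ∈ transvections W) {z : l ⊕ l → F}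
    (hz : ∀ w ∈ W, form z w = 0) : t.1 *ᵥ z = z := by
  induction ht using Subgroup.closure_induction with
  | mem t ht =>
    obtain ⟨u, hu, a, rfl⟩ := ht
    simp [transvection_mulVec, hz u hu]
  | one => exact one_mulVec z
  | mul s t _ _ hs ht => rw [mul_mulVec, ht, hs]
  | inv t _ ht => rw [← ht, inv_mulVec_mulVec, ht]

theorem exists_mem_form_ne_zero {W : Submodule F (l ⊕ l → F)} {x y : l ⊕ l → F}
    (hx : ∃ z ∈ W, form x z ≠ 0) (hy : ∃ z ∈ W, form y z ≠ 0) :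
    ∃ z ∈ W, form x z ≠ 0 ∧ form y z ≠ 0 := by
  obtain ⟨z, hz, hxz⟩ := hx
  obtain ⟨w, hw, hyw⟩ := hy
  by_cases hyz : form y z = 0
  · by_cases hxw : form x w = 0
    · exact ⟨z + w, W.add_mem hz hw, by simp [hxz, hxw], by simp [hyz, hyw]⟩
    · exact ⟨w, hw, hxw, hyw⟩
  · exact ⟨z, hz, hxz, hyz⟩

theorem exists_transvections_mulVec_eq {W : Submodule F (l ⊕ l → F)} {x y : l ⊕ l → F}
    (hx : x ∈ W) (hy : y ∈ W) (hx' : ∃ z ∈ W, form x z ≠ 0) (hy' : ∃ z ∈ W, form y z ≠ 0) :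
    ∃ t ∈ transvections W, t.1 *ᵥ x = y := by
  obtain ⟨z, hz, hxz, hyz⟩ := exists_mem_form_ne_zero hx' hy'
  rw [form_swap, neg_ne_zero] at hyz
  refine ⟨_, mul_mem (transvection_mem (W.sub_mem hz hy) (form z y)⁻¹)
    (transvection_mem (W.sub_mem hx hz) (form x z)⁻¹), ?_⟩
  rw [mul_mulVec, transvection_sub_mulVec hxz, transvection_sub_mulVec hyz]

theorem exists_transvections_mulVec_eq_of_fix {W : Submodule F (l ⊕ l → F)} {x y z : l ⊕ l → F}
    (hx : x ∈ W) (hy : y ∈ W) (hz : z ∈ W) (hxy : form x y ≠ 0) (h : form x y = form x z) :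
    ∃ t ∈ transvections W, t.1 *ᵥ x = x ∧ t.1 *ᵥ y = z := by
  have key : ∀ y ∈ W, ∀ z ∈ W, form x y = form x z → form y z ≠ 0 →
      ∃ t ∈ transvections W, t.1 *ᵥ x = x ∧ t.1 *ᵥ y = z := fun y hy z hz h hyz =>
    ⟨_, transvection_mem (W.sub_mem hy hz) (form y z)⁻¹,
      by simp [transvection_mulVec, h], transvection_sub_mulVec hyz⟩
  by_cases hyz : form y z = 0
  · have hxz : form x z ≠ 0 := h ▸ hxy
    obtain ⟨s, hs, hsx, hsy⟩ := key y hy (x + y) (W.add_mem hx hy) (by simp)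
      (by rw [form_swap]; simpa using hxy)
    obtain ⟨t, ht, htx, hty⟩ := key (x + y) (W.add_mem hx hy) z hz (by simpa using h)
      (by simpa [hyz] using hxz)
    exact ⟨t * s, mul_mem ht hs, by rw [mul_mulVec, hsx, htx], by rw [mul_mulVec, hsy, hty]⟩
  · exact key y hy z hz h hyz

theorem exists_mulVec_eq {x y : l ⊕ l → F} (hx : x ≠ 0) (hy : y ≠ 0) :
    ∃ g : symplecticGroup l F, g.1 *ᵥ x = y := by
  obtain ⟨z, hz⟩ := exists_form_ne_zero hx
  obtain ⟨w, hw⟩ := exists_form_ne_zero hy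
  obtain ⟨t, -, ht⟩ := exists_transvections_mulVec_eq (W := ⊤) (Submodule.mem_top)
    (Submodule.mem_top) ⟨z, trivial, hz⟩ ⟨w, trivial, hw⟩
  exact ⟨t, ht⟩

/-- The vectors whose coordinates indexed by `S` vanish. -/
def coordZero (F : Type*) [Field F] (S : Finset l) : Submodule F (l ⊕ l → F) where
  carrier := {w | ∀ i ∈ S, w (.inl i) = 0 ∧ w (.inr i) = 0}
  add_mem' hv hw i hi := by simp [hv i hi, hw i hi]
  zero_mem' i _ := by simp
  smul_mem' c v hv i hi := by simp [hv i hi]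

theorem exists_transvections_mul_fix (S : Finset l) (g : symplecticGroup l F) :
    ∃ t ∈ transvections (⊤ : Submodule F (l ⊕ l → F)), ∀ i ∈ S,
      (t * g).1 *ᵥ Pi.single (.inl i) 1 = Pi.single (.inl i) 1 ∧
      (t * g).1 *ᵥ Pi.single (.inr i) 1 = Pi.single (.inr i) 1 := by
  induction S using Finset.induction_on with
  | empty => exact ⟨1, one_mem _, by simp⟩
  | insert j S hj ih =>
    obtain ⟨t, ht, hS⟩ := ih
    obtain ⟨h, hh⟩ : ∃ h, h = t * g := ⟨_, rfl⟩
    rw [← hh] at hS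
    have hmono : ∀ s ∈ transvections (coordZero F S),
        s ∈ transvections (⊤ : Submodule F (l ⊕ l → F)) := fun s hs =>
      by
      refine Subgroup.closure_mono ?_ hs
      rintro _ ⟨u, -, a, rfl⟩
      exact ⟨u, trivial, a, rfl⟩
    have hfix : ∀ s ∈ transvections (coordZero F S), ∀ i ∈ S,
        s.1 *ᵥ Pi.single (.inl i) 1 = Pi.single (.inl i) 1 ∧
        s.1 *ᵥ Pi.single (.inr i) 1 = Pi.single (.inr i) 1 := fun s hs i hi =>
      ⟨mulVec_eq_self_of_mem_transvections hs fun w hw => by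
          rw [form_swap, form_single_inl, (hw i hi).2, neg_zero],
        mulVec_eq_self_of_mem_transvections hs fun w hw => by
          rw [form_swap, form_single_inr, (hw i hi).1, neg_zero, neg_zero]⟩
    have hne : ∀ i ∈ S, i ≠ j := fun i hi => by rintro rfl; exact hj hi
    have he : (Pi.single (.inl j) 1 : l ⊕ l → F) ∈ coordZero F S := fun i hi => by
      simp [hne i hi]
    have hf : (Pi.single (.inr j) 1 : l ⊕ l → F) ∈ coordZero F S := fun i hi => by
      simp [hne i hi]
    have hmem : ∀ k : symplecticGroup l F, (∀ i ∈ S,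
        k.1 *ᵥ Pi.single (.inl i) 1 = Pi.single (.inl i) 1 ∧
        k.1 *ᵥ Pi.single (.inr i) 1 = Pi.single (.inr i) 1) → ∀ w ∈ coordZero F S,
        k.1 *ᵥ w ∈ coordZero F S := fun k hk w hw i hi => by
      constructor
      · rw [← neg_eq_zero, ← form_single_inr (k.1 *ᵥ w), ← (hk i hi).2, form_mulVec, form_single_inr,
          (hw i hi).1, neg_zero]
      · rw [← form_single_inl (k.1 *ᵥ w), ← (hk i hi).1, form_mulVec, form_single_inl, (hw i hi).2]
    have hef : form (Pi.single (.inl j) 1 : l ⊕ l → F) (Pi.single (.inr j) 1) = -1 := by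
      simp [form_single_inr]
    obtain ⟨s, hs, hse⟩ := exists_transvections_mulVec_eq (hmem h hS _ he) he
      ⟨_, hmem h hS _ hf, by rw [form_mulVec, hef]; simp⟩ ⟨_, hf, by rw [hef]; simp⟩
    have hsS : ∀ i ∈ S, (s * h).1 *ᵥ Pi.single (.inl i) 1 = Pi.single (.inl i) 1 ∧
        (s * h).1 *ᵥ Pi.single (.inr i) 1 = Pi.single (.inr i) 1 := fun i hi => by
      rw [mul_mulVec, mul_mulVec, (hS i hi).1, (hS i hi).2]
      exact hfix s hs i hi
    have hse' : (s * h).1 *ᵥ Pi.single (.inl j) 1 = Pi.single (.inl j) 1 := by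
      rw [mul_mulVec, hse]
    have hxy : form (Pi.single (.inl j) 1) ((s * h).1 *ᵥ Pi.single (.inr j) 1) = (-1 : F) := by
      conv_lhs => rw [← hse']
      rw [form_mulVec, hef]
    obtain ⟨r, hr, hre, hrf⟩ := exists_transvections_mulVec_eq_of_fix he
      (hmem (s * h) hsS _ hf) hf (by rw [hxy]; simp) (by rw [hxy, hef])
    refine ⟨r * s * t, mul_mem (mul_mem (hmono r hr) (hmono s hs)) ht, fun i hi => ?_⟩
    have : r * s * t * g = r * (s * h) := by simp only [hh, mul_assoc]
    rw [this, mul_mulVec, mul_mulVec r]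
    obtain rfl | hi := Finset.mem_insert.1 hi
    · rw [hse']
      exact ⟨hre, hrf⟩
    · rw [(hsS i hi).1, (hsS i hi).2]
      exact hfix r hr i hi

theorem transvections_top : transvections (⊤ : Submodule F (l ⊕ l → F)) = ⊤ := by
  refine (Subgroup.eq_top_iff' _).2 fun g => ?_
  obtain ⟨t, ht, h⟩ := exists_transvections_mul_fix Finset.univ g
  have : t * g = 1 := Subtype.ext <| Matrix.ext_of_mulVec_single fun i => by
    change (t * g).1 *ᵥ _ = (1 : symplecticGroup l F).1 *ᵥ _
    rw [one_mulVec]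
    obtain i | i := i
    exacts [(h i (Finset.mem_univ i)).1, (h i (Finset.mem_univ i)).2]
  rw [eq_inv_of_mul_eq_one_right this]
  exact inv_mem ht

theorem eq_top_of_transvection_mem {H : Subgroup (symplecticGroup l F)}
    (h : ∀ u a, u ≠ 0 → transvection u a ∈ H) : H = ⊤ := by
  rw [eq_top_iff, ← transvections_top, transvections, Subgroup.closure_le]
  rintro _ ⟨u, -, a, rfl⟩
  obtain rfl | hu := eq_or_ne u 0
  · rw [show transvection (0 : l ⊕ l → F) a = 1 from
      ext_mulVec fun v => by simp [transvection_mulVec]]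
    exact one_mem H
  · exact h u a hu

theorem of_transvection_eq {u v : l ⊕ l → F} (hu : u ≠ 0) (hv : v ≠ 0) (a : F) :
    Abelianization.of (transvection u a) = Abelianization.of (transvection v a) := by
  obtain ⟨g, rfl⟩ := exists_mulVec_eq hu hv
  rw [← conj_transvection, map_mul, map_mul, map_inv, mul_inv_cancel_comm]

theorem transvection_parallelogram {u w : l ⊕ l → F} (h : form u w = 0) (a : F) :
    transvection (u + w) a * transvection (u - w) a =
      transvection u (2 * a) * transvection w (2 * a) := by
  have h' : form w u = 0 := by rw [form_swap, h, neg_zero]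
  refine ext_mulVec fun v => ?_
  simp only [mul_mulVec, transvection_mulVec, map_add, map_sub, map_smul, LinearMap.add_apply,
    LinearMap.sub_apply, LinearMap.smul_apply, smul_eq_mul, form_self, h, h']
  module

theorem transvection_parallelepiped {u v w : l ⊕ l → F} (huv : form u v = 0)
    (huw : form u w = 0) (hvw : form v w = 0) (a : F) :
    transvection (u + v + w) a * transvection u a * transvection v a * transvection w a =
      transvection (u + v) a * transvection (u + w) a * transvection (v + w) a := by
  have hvu : form v u = 0 := by rw [form_swap, huv, neg_zero]
  have hwu : form w u = 0 := by rw [form_swap, huw, neg_zero]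
  have hwv : form w v = 0 := by rw [form_swap, hvw, neg_zero]
  refine ext_mulVec fun x => ?_
  simp only [mul_mulVec, transvection_mulVec, map_add, map_smul, LinearMap.add_apply,
    LinearMap.smul_apply, smul_eq_mul, form_self, huv, huw, hvw, hvu, hwu, hwv]
  module

theorem form_single_inl_inl (i j : l) :
    form (Pi.single (.inl i) 1 : l ⊕ l → F) (Pi.single (.inl j) 1) = 0 := by
  simp [form_single_inl]

/-- The symplectic group over a field is perfect, except in small cases. -/
theorem commutator_eq_top
    (h : (∃ c : F, c ≠ 0 ∧ c ^ 2 ≠ 1) ∨ ((2 : F) ≠ 0 ∧ 2 ≤ Fintype.card l) ∨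
      3 ≤ Fintype.card l) : commutator (symplecticGroup l F) = ⊤ := by
  refine eq_top_of_transvection_mem fun u a hu => ?_
  rw [← Abelianization.ker_of, MonoidHom.mem_ker]
  have he : ∀ i : l, (Pi.single (.inl i) 1 : l ⊕ l → F) ≠ 0 := fun i => by simp
  have he₂ : ∀ i j : l, i ≠ j → (Pi.single (.inl i) 1 + Pi.single (.inl j) 1 : l ⊕ l → F) ≠ 0 :=
    fun i j hij h0 => by simpa [hij] using congrFun h0 (.inl i)
  obtain ⟨c, hc, hc2⟩ | ⟨h2, hl⟩ | hl := h
  · have hc2' : c ^ 2 - 1 ≠ 0 := sub_ne_zero.2 hc2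
    have := of_transvection_eq (smul_ne_zero hc hu) hu (a / (c ^ 2 - 1))
    rw [transvection_smul, show c ^ 2 * (a / (c ^ 2 - 1)) = a + a / (c ^ 2 - 1) by
      field_simp; ring, transvection_add, map_mul] at this
    exact mul_eq_right.1 this
  · have : NeZero (2 : F) := ⟨h2⟩
    obtain ⟨i, j, hij⟩ := Fintype.exists_pair_of_one_lt_card hl
    have hs : (Pi.single (.inl i) 1 - Pi.single (.inl j) 1 : l ⊕ l → F) ≠ 0 := fun h0 => by
      simpa [hij] using congrFun h0 (.inl i)
    have key := congrArg Abelianization.of (transvection_parallelogram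
      (form_single_inl_inl (F := F) i j) (a / 2))
    rw [mul_div_cancel₀ a h2, map_mul, map_mul, of_transvection_eq (he i) hu,
      of_transvection_eq (he j) hu, of_transvection_eq (he₂ i j hij) hu,
      of_transvection_eq hs hu, ← map_mul, ← transvection_add, add_halves] at key
    exact left_eq_mul.1 key
  · obtain ⟨i, j, k, hij, hik, hjk⟩ := Fintype.two_lt_card_iff.1 hl
    have hs :
        (Pi.single (.inl i) 1 + Pi.single (.inl j) 1 + Pi.single (.inl k) 1 : l ⊕ l → F) ≠ 0 :=
      fun h0 => by simpa [hij, hik] using congrFun h0 (.inl i)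
    have key := congrArg Abelianization.of (transvection_parallelepiped
      (form_single_inl_inl (F := F) i j) (form_single_inl_inl i k) (form_single_inl_inl j k) a)
    simp only [map_mul] at key
    rw [of_transvection_eq (he i) hu, of_transvection_eq (he j) hu,
      of_transvection_eq (he k) hu, of_transvection_eq hs hu,
      of_transvection_eq (he₂ i j hij) hu, of_transvection_eq (he₂ i k hik) hu,
      of_transvection_eq (he₂ j k hjk) hu] at key
    exact mul_eq_left.1 key

theorem mem_center_of_forall_mulVec {g : symplecticGroup l F}
    (h : ∀ v, ∃ c : F, g.1 *ᵥ v = c • v) : g ∈ Subgroup.center (symplecticGroup l F) := by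
  have key : ∀ u v, form u v ≠ 0 → ∀ c d : F, g.1 *ᵥ u = c • u → g.1 *ᵥ v = d • v → c = d := by
    intro u v huv c d hc hd
    obtain ⟨e, he⟩ := h (u + v)
    rw [mulVec_add, hc, hd] at he
    have h1 := congrArg (form u) he
    have h2 := congrArg (form v) he
    have hvu : form v u ≠ 0 := by rwa [form_swap, neg_ne_zero]
    simp only [map_add, map_smul, form_self, smul_eq_mul, mul_zero, zero_add, add_zero] at h1 h2
    rw [mul_right_cancel₀ hvu h2, mul_right_cancel₀ huv h1]
  have hcent : ∀ u a, u ≠ 0 →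
      transvection u a ∈ Subgroup.centralizer {g} := by
    intro u a hu
    obtain ⟨v, huv⟩ := exists_form_ne_zero hu
    obtain ⟨c, hc⟩ := h u
    obtain ⟨d, hd⟩ := h v
    have hcd := key u v huv c d hc hd
    have h1 := form_mulVec g u v
    rw [hc, hd, ← hcd] at h1
    simp only [map_smul, LinearMap.smul_apply, smul_eq_mul] at h1
    have h2 : c ^ 2 = 1 := mul_right_cancel₀ huv (by rw [one_mul]; linear_combination h1)
    have h3 := conj_transvection g u a
    rw [hc, transvection_smul, h2, one_mul] at h3
    rw [Subgroup.mem_centralizer_singleton_iff]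
    exact (mul_inv_eq_iff_eq_mul.1 h3).symm
  have := eq_top_of_transvection_mem hcent
  rw [Subgroup.mem_center_iff]
  intro k
  exact Subgroup.mem_centralizer_singleton_iff.1 (this ▸ Subgroup.mem_top k)

theorem exists_form_eq_zero_ne_zero {x y : l ⊕ l → F} (hx : x ≠ 0) (h : ∀ c : F, y ≠ c • x) :
    ∃ z, form x z = 0 ∧ form y z ≠ 0 := by
  by_contra! H
  obtain ⟨w, hw⟩ := exists_form_ne_zero hx
  refine h (form y w / form x w) (sub_eq_zero.1 (form_nondegenerate fun z => ?_))
  have := H (z - (form x z / form x w) • w) (by simp [hw])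
  simp only [map_sub, map_smul, smul_eq_mul, LinearMap.sub_apply, LinearMap.smul_apply] at this ⊢
  rw [← this]
  ring

/-- `N` moves the line of `x` to the line of `y`. -/
def LineRel (N : Subgroup (symplecticGroup l F)) (x y : l ⊕ l → F) : Prop :=
  ∃ h ∈ N, ∃ c : F, c ≠ 0 ∧ h.1 *ᵥ x = c • y

namespace LineRel

variable {N : Subgroup (symplecticGroup l F)} {x y z : l ⊕ l → F}

theorem trans (h₁ : LineRel N x y) (h₂ : LineRel N y z) : LineRel N x z := by
  obtain ⟨g, hg, c, hc, hgx⟩ := h₁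
  obtain ⟨k, hk, d, hd, hky⟩ := h₂
  exact ⟨k * g, mul_mem hk hg, c * d, mul_ne_zero hc hd, by
    rw [mul_mulVec, hgx, mulVec_smul, hky, smul_smul]⟩

theorem map [hN : N.Normal] (h : LineRel N x y) (g : symplecticGroup l F) :
    LineRel N (g.1 *ᵥ x) (g.1 *ᵥ y) := by
  obtain ⟨k, hk, c, hc, hkx⟩ := h
  exact ⟨g * k * g⁻¹, hN.conj_mem k hk g, c, hc, by
    rw [mul_mulVec, mul_mulVec, inv_mulVec_mulVec, hkx, mulVec_smul]⟩

theorem smul_right {c : F} (hc : c ≠ 0) (h : LineRel N x y) : LineRel N x (c • y) := by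
  obtain ⟨k, hk, d, hd, hkx⟩ := h
  exact ⟨k, hk, d / c, div_ne_zero hd hc, by rw [hkx, smul_smul, div_mul_cancel₀ d hc]⟩

theorem of_smul {c : F} (hc : c ≠ 0) : LineRel N x (c • x) :=
  smul_right hc ⟨1, one_mem N, 1, one_ne_zero, by rw [one_mulVec, one_smul]⟩

theorem of_form_ne_zero [N.Normal] (h : LineRel N x y) (hxy : form x y ≠ 0)
    {x' y' : l ⊕ l → F} (hxy' : form x' y' ≠ 0) : LineRel N x' y' := by
  have hx : x ≠ 0 := by rintro rfl; simp at hxy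
  have hx' : x' ≠ 0 := by rintro rfl; simp at hxy'
  obtain ⟨g, hg⟩ := exists_mulVec_eq hx hx'
  set c := form x y / form x' y'
  have hc : c ≠ 0 := div_ne_zero hxy hxy'
  have hgy : form x' (g.1 *ᵥ y) = form x y := by rw [← hg, form_mulVec]
  obtain ⟨t, -, htx, hty⟩ := exists_transvections_mulVec_eq_of_fix (W := ⊤) (x := x')
    (y := g.1 *ᵥ y) (z := c • y') trivial trivial trivial (by rwa [hgy])
    (by rw [hgy, map_smul, smul_eq_mul, div_mul_cancel₀ _ hxy'])
  have := (h.map g).map t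
  rw [hg, htx, hty] at this
  simpa [smul_smul, hc] using this.smul_right (inv_ne_zero hc)

theorem of_form_eq_zero [N.Normal] (h : LineRel N x y) (hx : x ≠ 0) (hxy : form x y = 0)
    (hne : ∀ c : F, y ≠ c • x) {x' y' : l ⊕ l → F} (hx' : x' ≠ 0) (hxy' : form x' y' = 0)
    (hne' : ∀ c : F, y' ≠ c • x') : LineRel N x' y' := by
  obtain ⟨g, hg⟩ := exists_mulVec_eq hx hx'
  have hgy : form x' (g.1 *ᵥ y) = 0 := by rw [← hg, form_mulVec, hxy]
  have hgne : ∀ c : F, g.1 *ᵥ y ≠ c • x' := fun c hc => hne c <| by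
    rw [← inv_mulVec_mulVec g y, hc, mulVec_smul, ← hg, inv_mulVec_mulVec]
  obtain ⟨t, ht, hty⟩ := exists_transvections_mulVec_eq (W := LinearMap.ker (form x')) hgy hxy'
    (exists_form_eq_zero_ne_zero hx' hgne) (exists_form_eq_zero_ne_zero hx' hne')
  have := (h.map g).map t
  rwa [hg, hty, mulVec_eq_self_of_mem_transvections ht fun w hw => hw] at this

theorem of_not_le_center [N.Normal] (hN : ¬ N ≤ Subgroup.center (symplecticGroup l F))
    (hx : x ≠ 0) (hy : y ≠ 0) : LineRel N x y := by
  obtain ⟨g, hgN, hg⟩ := SetLike.not_le_iff_exists.1 hN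
  obtain ⟨u, hu⟩ : ∃ u, ∀ c : F, g.1 *ᵥ u ≠ c • u := by
    contrapose! hg
    exact mem_center_of_forall_mulVec hg
  have hu0 : u ≠ 0 := by
    rintro rfl
    exact hu 0 (by simp)
  have hgu : LineRel N u (g.1 *ᵥ u) := ⟨g, hgN, 1, one_ne_zero, (one_smul F _).symm⟩
  by_cases hform : form u (g.1 *ᵥ u) = 0
  · have key : ∀ {x y : l ⊕ l → F}, x ≠ 0 → y ≠ 0 → form x y = 0 → LineRel N x y := by
      intro x y hx hy hxy
      by_cases hc : ∃ c : F, y = c • x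
      · obtain ⟨c, rfl⟩ := hc
        exact of_smul (by rintro rfl; simp at hy)
      · push Not at hc
        exact hgu.of_form_eq_zero hu0 hform hu hx hxy hc
    by_cases hxy : form x y = 0
    · exact key hx hy hxy
    · obtain ⟨z, hz, hxz, hyz⟩ : ∃ z, z ≠ 0 ∧ form x z = 0 ∧ form z y = 0 := by
        obtain ⟨k, hk⟩ := exists_mulVec_eq hu0 hx
        set v := k.1 *ᵥ (g.1 *ᵥ u)
        have hxv : form x v = 0 := by rw [← hk, form_mulVec, hform]
        have hv : ∀ c : F, v ≠ c • x := fun c hc => hu c <| by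
          rw [← inv_mulVec_mulVec k (g.1 *ᵥ u)]
          refine (congrArg _ hc).trans ?_
          rw [mulVec_smul, ← hk, inv_mulVec_mulVec]
        refine ⟨v - (form v y / form x y) • x, sub_ne_zero.2 (hv _), by simp [hxv], ?_⟩
        simp [hxy]
      exact (key hx hz hxz).trans (key hz hy hyz)
  · obtain ⟨w, hw⟩ := exists_form_ne_zero hx
    obtain ⟨v, hv⟩ := exists_form_ne_zero hy
    obtain ⟨z, -, hxz, hyz⟩ := exists_mem_form_ne_zero (W := ⊤) ⟨w, trivial, hw⟩ ⟨v, trivial, hv⟩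
    rw [form_swap, neg_ne_zero] at hyz
    exact (hgu.of_form_ne_zero hform hxz).trans (hgu.of_form_ne_zero hform hyz)

end LineRel

/-- The transvections along a fixed vector, as a homomorphism from the additive group of the
field. -/
noncomputable def transvectionHom (u : l ⊕ l → F) : Multiplicative F →* symplecticGroup l F where
  toFun a := transvection u a.toAdd
  map_one' := transvection_zero u
  map_mul' a b := transvection_add u a.toAdd b.toAdd

theorem transvection_mem_range_transvectionHom (u : l ⊕ l → F) (a : F) :
    transvection u a ∈ (transvectionHom u).range :=
  ⟨.ofAdd a, rfl⟩

theorem commutator_le_of_not_le_center (N : Subgroup (symplecticGroup l F)) [hN : N.Normal]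
    (h : ¬ N ≤ Subgroup.center (symplecticGroup l F)) : commutator (symplecticGroup l F) ≤ N := by
  obtain hV | ⟨x, hx⟩ := forall_or_exists_not fun x : l ⊕ l → F => x = 0
  · exact (h fun g _ => mem_center_of_forall_mulVec fun v => ⟨0, by simp [hV v]⟩).elim
  set A := (transvectionHom x).range with hA
  suffices N ⊔ A = ⊤ from
    hN.commutator_le_of_self_sup_commutative_eq_top this (hA ▸ inferInstance)
  refine eq_top_of_transvection_mem fun y a hy => ?_
  obtain ⟨g, hg, c, hc, hgx⟩ := LineRel.of_not_le_center h hx hy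
  have hconj : transvection y a = g * transvection x (a / c ^ 2) * g⁻¹ := by
    rw [conj_transvection, hgx, transvection_smul, mul_div_cancel₀ _ (pow_ne_zero 2 hc)]
  have hgN : g ∈ N ⊔ A := Subgroup.mem_sup_left hg
  have hxA : transvection x (a / c ^ 2) ∈ A := 
    transvection_mem_range_transvectionHom x _
  rw [hconj]
  exact mul_mem (mul_mem hgN (Subgroup.mem_sup_right hxA)) (inv_mem hgN)

theorem isSimpleGroup_quotient_center [Nonempty l]
    (h : commutator (symplecticGroup l F) = ⊤) :
    IsSimpleGroup (symplecticGroup l F ⧸ Subgroup.center (symplecticGroup l F)) := by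
  have hne : Subgroup.center (symplecticGroup l F) ≠ ⊤ := fun hc => by
    have hbot : commutator (symplecticGroup l F) = ⊥ := by
      rw [commutator_def, Subgroup.commutator_eq_bot_iff_le_centralizer, Subgroup.coe_top,
        Subgroup.centralizer_univ, hc]
    rw [hbot] at h
    obtain ⟨i⟩ := ‹Nonempty l›
    obtain ⟨g, hg⟩ := exists_mulVec_eq (x := (Pi.single (.inl i) 1 : l ⊕ l → F))
      (y := Pi.single (.inr i) 1) (by simp) (by simp)
    have hg1 : g ∈ (⊥ : Subgroup (symplecticGroup l F)) := h ▸ Subgroup.mem_top g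
    rw [Subgroup.mem_bot.1 hg1, one_mulVec] at hg
    simpa using congrFun hg (.inl i)
  have : Nontrivial (symplecticGroup l F ⧸ Subgroup.center (symplecticGroup l F)) :=
    QuotientGroup.nontrivial_iff.2 hne
  refine ⟨fun H hH => ?_⟩
  have hs := QuotientGroup.mk'_surjective (Subgroup.center (symplecticGroup l F))
  rw [← Subgroup.map_comap_eq_self_of_surjective hs H]
  by_cases hle : H.comap (QuotientGroup.mk' _) ≤ Subgroup.center (symplecticGroup l F)
  · left
    rw [Subgroup.map_eq_bot_iff, QuotientGroup.ker_mk']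
    exact hle
  · right
    rw [top_le_iff.1 (h.ge.trans (commutator_le_of_not_le_center _ hle))]
    exact Subgroup.map_top_of_surjective _ hs

end SymplecticGroup

/-- For a prime `p` and `n ≥ 1` with `(n,p)` not equal to `(1,2)`, `(1,3)` or
`(2,2)`, the quotient of `Sp(2n, ℤ/pℤ)` by its center is simple. -/
theorem psp_simple (p n : ℕ) (hp : p.Prime) (hn : 1 ≤ n)
    (h12 : ¬(n = 1 ∧ p = 2)) (h13 : ¬(n = 1 ∧ p = 3)) (h22 : ¬(n = 2 ∧ p = 2)) :
    IsSimpleGroup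
      (Matrix.symplecticGroup (Fin n) (ZMod p) ⧸
        Subgroup.center (Matrix.symplecticGroup (Fin n) (ZMod p))) := by
  have : Fact p.Prime := ⟨hp⟩
  have : Nonempty (Fin n) := ⟨⟨0, hn⟩⟩
  refine SymplecticGroup.isSimpleGroup_quotient_center (SymplecticGroup.commutator_eq_top ?_)
  rw [Fintype.card_fin]
  have two_ne_zero : p ≠ 2 → (2 : ZMod p) ≠ 0 := fun hp2 h => hp2 <|
    (Nat.prime_dvd_prime_iff_eq hp Nat.prime_two).1 <|
      (ZMod.natCast_eq_zero_iff 2 p).1 (by exact_mod_cast h)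
  obtain hn1 | hn2 | hn3 : n = 1 ∨ n = 2 ∨ 3 ≤ n := by omega
  · refine Or.inl ⟨2, two_ne_zero fun h => h12 ⟨hn1, h⟩, fun h => h13 ⟨hn1, ?_⟩⟩
    have h3 : ((3 : ℕ) : ZMod p) = 0 := by
      push_cast
      linear_combination h
    exact (Nat.prime_dvd_prime_iff_eq hp Nat.prime_three).1 ((ZMod.natCast_eq_zero_iff 3 p).1 h3)
  · exact Or.inr (Or.inl ⟨two_ne_zero fun h => h22 ⟨hn2, h⟩, hn2.ge⟩)
  · exact Or.inr (Or.inr hn3)
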